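/- Let ν, M ∈ ℝ, let K : ℝ → ℝ be continuously differentiable with K(u) > 0 for all u, let J : ℝ → ℝ satisfy J'(u) = K(u) for all u, and set G(u) = (2(2−ν)M − J(u))/K(u). Define vector fields on ℝ³ (with coordinates (z,t,u)) by Y₁(z,t,u) = (z/2, t, 0) and Y₄(z,t,u) = (z^{2−ν}, 0, −G(u)·z^{1−ν}), where z^{2−ν} and z^{1−ν} are real powers. Then at every point p = (z,t,u) with z > 0, the Lie bracket satisfies [Y₁, Y₄](p) = ((1−ν)/2) · Y₄(p). -/

import Mathlib

/-- The commutator-table entry `[Y₁, Y₄] = ((1−ν)/2) Y₄` for the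
generators `Y₁ = (z/2)∂_z + t∂_t` and
`Y₄ = z^{2−ν}∂_z − ((2(2−ν)M − ∫K du)/K) z^{1−ν}∂_u`, where the Lie bracket of vector
fields `X, Y : ℝ³ → ℝ³` is `[X,Y](p) = DY(p)·X(p) − DX(p)·Y(p)`. -/
theorem stmt18 (ν M : ℝ)
    (K J : ℝ → ℝ) (hK : ContDiff ℝ 1 K) (hKpos : ∀ x, 0 < K x)
    (hJ : ∀ x, HasDerivAt J (K x) x)
    (G : ℝ → ℝ) (hG : ∀ x, G x = (2 * (2 - ν) * M - J x) / K x)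
    (Y₁ Y₄ : ℝ × ℝ × ℝ → ℝ × ℝ × ℝ)
    (hY₁ : ∀ p : ℝ × ℝ × ℝ, Y₁ p = (p.1 / 2, p.2.1, 0))
    (hY₄ : ∀ p : ℝ × ℝ × ℝ, Y₄ p = (p.1 ^ (2 - ν), 0, -(G p.2.2) * p.1 ^ (1 - ν))) :
    ∀ p : ℝ × ℝ × ℝ, 0 < p.1 →
      fderiv ℝ Y₄ p (Y₁ p) - fderiv ℝ Y₁ p (Y₄ p) = ((1 - ν) / 2) • Y₄ p := by
  intro p hp
  have hG_diff : DifferentiableAt ℝ G p.2.2 := by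
    rw [funext hG]
    exact ((differentiableAt_const _).sub (hJ _).differentiableAt).div
      (hK.differentiable one_ne_zero _) (hKpos _).ne'
  have hz : HasFDerivAt (fun q : ℝ × ℝ × ℝ => q.1) (.fst ℝ ℝ (ℝ × ℝ)) p := hasFDerivAt_fst
  have ht : HasFDerivAt (fun q : ℝ × ℝ × ℝ => q.2.1)
      ((ContinuousLinearMap.fst ℝ ℝ ℝ).comp (.snd ℝ ℝ (ℝ × ℝ))) p :=
    hasFDerivAt_fst.comp p hasFDerivAt_snd
  have hu : HasFDerivAt (fun q : ℝ × ℝ × ℝ => q.2.2)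
      ((ContinuousLinearMap.snd ℝ ℝ ℝ).comp (.snd ℝ ℝ (ℝ × ℝ))) p :=
    hasFDerivAt_snd.comp p hasFDerivAt_snd
  have hpow (a : ℝ) := hz.rpow_const (p := a) (.inl hp.ne')
  have hGu := (hG_diff.hasDerivAt.comp_hasFDerivAt p hu).neg
  have hDY₁ := (hz.mul_const (2⁻¹ : ℝ)).prodMk (ht.prodMk (hasFDerivAt_const (0 : ℝ) p))
  have hDY₄ := (hpow (2 - ν)).prodMk
    ((hasFDerivAt_const (0 : ℝ) p).prodMk (hGu.mul (hpow (1 - ν))))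
  have hY₁_eq : Y₁ = fun q => (q.1 * 2⁻¹, q.2.1, 0) := by
    funext q
    rw [hY₁, div_eq_mul_inv]
  have hD₁ : HasFDerivAt Y₁ _ p := hY₁_eq ▸ hDY₁
  have hD₄ : HasFDerivAt Y₄ _ p := funext hY₄ ▸ hDY₄
  have hmul (a : ℝ) : p.1 ^ (a - 1) * p.1 = p.1 ^ a := by
    rw [Real.rpow_sub_one hp.ne', div_mul_cancel₀ _ hp.ne']
  rw [hD₁.fderiv, hD₄.fderiv, hY₁, hY₄]
  ext
  · simp
    linear_combination (2 - ν) / 2 * hmul (2 - ν)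
  · simp
  · have h : p.1 ^ (-ν) * p.1 = p.1 ^ (1 - ν) := by simpa using hmul (1 - ν)
    simp
    linear_combination G p.2.2 * (1 - ν) / 2 * h
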